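/- Let F be a finite field and ψ a nontrivial additive character of F. Then Σ_{g ∈ SL_2(F)} ψ(tr g) has absolute value at most |SL_2(F)| · C · |F|^{−3/2} for an absolute constant C; equivalently (1/|SL_2(F)|)|Σ_{g∈SL_2(F)} ψ(tr g)| ≪ |F|^{−3/2}. -/

import Mathlib

section SlTwoExponentialSum
open Finset Polynomial

/-- The Kloosterman sum of an additive character `ψ` on a finite field. -/
noncomputable def kloostermanSum {E : Type*} [Field E] [Fintype E] [DecidableEq E]
    (ψ : AddChar E ℂ) : ℂ :=
  ∑ x : Eˣ, ψ ((x : E) + (x : E)⁻¹)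

section SL2
variable {F : Type*} [Field F] [DecidableEq F]

/-- The Bruhat-type partition of `SL₂` according to the vanishing of the lower left entry. -/
def slTwoEquiv : Matrix.SpecialLinearGroup (Fin 2) F ≃ (Fˣ × F × F) ⊕ (Fˣ × F) where
  toFun g := if h : g.val 1 0 = 0 then
      .inr (⟨g.val 0 0, g.val 1 1, by have := g.2; rw [Matrix.det_fin_two] at this; simp_all,
        by have := g.2; rw [Matrix.det_fin_two] at this; rw [mul_comm]; simp_all⟩, g.val 0 1)
    else .inl (Units.mk0 (g.val 1 0) h, g.val 0 0, g.val 1 1)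
  invFun s := match s with
    | .inl (c, a, d) => ⟨!![a, (a * d - 1) * (c : F)⁻¹; c, d], by simp [Matrix.det_fin_two]⟩
    | .inr (a, b) => ⟨!![(a : F), b; 0, (a : F)⁻¹], by simp [Matrix.det_fin_two]⟩
  left_inv g := by
    have hg := g.2
    rw [Matrix.det_fin_two] at hg
    by_cases h : g.val 1 0 = 0
    · simp only [h, dif_pos]
      have hd : g.val 0 0 * g.val 1 1 = 1 := by simpa [h] using hg
      ext i j
      fin_cases i <;> fin_cases j <;> simp_all
      exact (eq_inv_of_mul_eq_one_right hd).symm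
    · simp only [h]
      ext i j
      fin_cases i <;> fin_cases j <;> simp_all
      rw [mul_inv_eq_iff_eq_mul₀ h]
      linear_combination hg
  right_inv s := by
    rcases s with ⟨c, a, d⟩ | ⟨a, b⟩
    · simp
    · simp

variable [Fintype F]

lemma sum_trace_slTwo (ψ : AddChar F ℂ) (hψ : ψ ≠ 1) :
    ∑ g : Matrix.SpecialLinearGroup (Fin 2) F, ψ (Matrix.trace g.val) =
      Fintype.card F * kloostermanSum ψ := by
  rw [← slTwoEquiv.symm.sum_comp, Fintype.sum_sum_type]
  simp only [slTwoEquiv, Equiv.coe_fn_symm_mk, Matrix.trace_fin_two, Fintype.sum_prod_type]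
  simp [AddChar.map_add_eq_mul, ← Finset.mul_sum, AddChar.sum_eq_zero_of_ne_one hψ,
    kloostermanSum]

lemma card_slTwo_ge :
    (Fintype.card F : ℝ) ^ 3 ≤ 2 * Fintype.card (Matrix.SpecialLinearGroup (Fin 2) F) := by
  have hq := Fintype.one_lt_card (α := F)
  rw [Fintype.card_congr slTwoEquiv, Fintype.card_sum, Fintype.card_prod, Fintype.card_prod,
    Fintype.card_prod, Fintype.card_units]
  obtain ⟨k, hk⟩ := Nat.exists_eq_add_of_le' hq
  rw [hk]
  push_cast [Nat.add_sub_cancel]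
  have : (0 : ℝ) ≤ k := by positivity
  nlinarith [mul_nonneg this this, mul_nonneg (mul_nonneg this this) this]

end SL2

section LFunction
variable {F : Type*} [Field F]

/-- The multiplicative function on monic polynomials `h` with `h(0) ≠ 0` whose value is
`ψ (∑ (x + x⁻¹))`, the sum being over the roots `x` of `h`. -/
noncomputable def rootChar (ψ : AddChar F ℂ) (h : F[X]) : ℂ :=
  ψ (-h.nextCoeff - h.coeff 1 / h.coeff 0)

lemma rootChar_one (ψ : AddChar F ℂ) : rootChar ψ 1 = 1 := by
  have h : (1 : F[X]).nextCoeff = 0 := by simp [nextCoeff]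
  simp [rootChar, coeff_one, h]

lemma rootChar_mul (ψ : AddChar F ℂ) {g h : F[X]} (hg : g.Monic) (hh : h.Monic)
    (hg0 : g.coeff 0 ≠ 0) (hh0 : h.coeff 0 ≠ 0) :
    rootChar ψ (g * h) = rootChar ψ g * rootChar ψ h := by
  rw [rootChar, rootChar, rootChar, ← AddChar.map_add_eq_mul, hg.nextCoeff_mul hh,
    mul_coeff_one, mul_coeff_zero]
  congr 1
  field_simp
  ring

lemma rootChar_pow (ψ : AddChar F ℂ) {g : F[X]} (hg : g.Monic) (hg0 : g.coeff 0 ≠ 0) (n : ℕ) :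
    rootChar ψ (g ^ n) = rootChar ψ g ^ n := by
  induction n with
  | zero => simp [rootChar_one]
  | succ n ih =>
    rw [pow_succ, rootChar_mul ψ (hg.pow n) hg (by
      rw [coeff_zero_eq_eval_zero, eval_pow, ← coeff_zero_eq_eval_zero]
      exact pow_ne_zero _ hg0) hg0, ih, pow_succ]

variable [Fintype F]

lemma finite_monic_natDegree (m : ℕ) :
    {h : F[X] | h.Monic ∧ h.natDegree = m ∧ h.coeff 0 ≠ 0}.Finite := by
  have : Finite (degreeLT F (m + 1)) := Finite.of_equiv _ (degreeLTEquiv F (m + 1)).symm.toEquiv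
  refine (Set.toFinite (degreeLT F (m + 1) : Set F[X])).subset fun h hh => ?_
  rw [SetLike.mem_coe, mem_degreeLT]
  exact (natDegree_lt_iff_degree_lt hh.1.ne_zero).1 (by rw [hh.2.1]; omega)

variable (F) in
/-- The monic polynomials of degree `m` over `F` with nonzero constant term. -/
noncomputable def monicPolys (m : ℕ) : Finset F[X] := (finite_monic_natDegree m).toFinset

lemma mem_monicPolys {m : ℕ} {h : F[X]} :
    h ∈ monicPolys F m ↔ h.Monic ∧ h.natDegree = m ∧ h.coeff 0 ≠ 0 := by
  simp [monicPolys]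

/-- The coefficients of the `L`-function of `rootChar ψ`. -/
noncomputable def lCoeff (ψ : AddChar F ℂ) (m : ℕ) : ℂ := ∑ h ∈ monicPolys F m, rootChar ψ h

lemma lCoeff_zero (ψ : AddChar F ℂ) : lCoeff ψ 0 = 1 := by
  have : monicPolys F 0 = {1} := by
    ext h
    rw [mem_monicPolys, Finset.mem_singleton]
    refine ⟨fun hh => hh.1.natDegree_eq_zero.1 hh.2.1, ?_⟩
    rintro rfl
    simp
  rw [lCoeff, this, Finset.sum_singleton, rootChar_one]

lemma lCoeff_one [DecidableEq F] (ψ : AddChar F ℂ) : lCoeff ψ 1 = kloostermanSum ψ := by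
  symm
  refine Finset.sum_bij (fun x _ => X - C (x : F)) ?_ ?_ ?_ ?_
  · intro x _
    rw [mem_monicPolys]
    exact ⟨monic_X_sub_C _, natDegree_X_sub_C _, by simp⟩
  · intro x _ y _ hxy
    simpa [Units.ext_iff] using hxy
  · intro h hh
    rw [mem_monicPolys] at hh
    refine ⟨Units.mk0 (-h.coeff 0) (neg_ne_zero.2 hh.2.2), Finset.mem_univ _, ?_⟩
    conv_rhs => rw [hh.1.eq_X_add_C hh.2.1]
    simp
  · intro x _
    simp [rootChar, nextCoeff, div_eq_mul_inv]

lemma lCoeff_two [DecidableEq F] (ψ : AddChar F ℂ) (hψ : ψ ≠ 1) :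
    lCoeff ψ 2 = Fintype.card F := by
  have key : lCoeff ψ 2 = ∑ b : Fˣ, ∑ a : F, ψ (a * (-1 - (b : F)⁻¹)) := by
    rw [← Fintype.sum_prod_type']
    symm
    refine Finset.sum_bij (fun x _ => C 1 * X ^ 2 + C x.2 * X + C (x.1 : F)) ?_ ?_ ?_ ?_
    · intro x _
      rw [mem_monicPolys]
      refine ⟨?_, natDegree_quadratic one_ne_zero, by simp⟩
      exact leadingCoeff_quadratic one_ne_zero
    · rintro ⟨b, a⟩ _ ⟨b', a'⟩ _ hxy
      have h0 := congrArg (coeff · 0) hxy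
      have h1 := congrArg (coeff · 1) hxy
      simp [coeff_X, coeff_C, coeff_X_pow] at h0 h1
      exact Prod.ext (Units.ext h0) h1
    · intro h hh
      rw [mem_monicPolys] at hh
      refine ⟨(Units.mk0 (h.coeff 0) hh.2.2, h.coeff 1), Finset.mem_univ _, ?_⟩
      conv_rhs => rw [hh.1.as_sum, hh.2.1]
      simp [Finset.sum_range_succ]
      ring
    · rintro ⟨b, a⟩ _
      have h2 : (C 1 * X ^ 2 + C a * X + C (b : F)).natDegree = 2 :=
        natDegree_quadratic one_ne_zero
      rw [rootChar, nextCoeff_of_natDegree_pos (by rw [h2]; norm_num), h2]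
      simp [coeff_X, coeff_C, coeff_X_pow]
      congr 1
      field_simp
  rw [key, Finset.sum_eq_single (-1)]
  · simp
  · intro b _ hb
    rw [AddChar.sum_mulShift _ (AddChar.IsPrimitive.of_ne_one hψ), if_neg]
    · simp
    intro h
    apply hb
    rw [← inv_inj, Units.ext_iff]
    simp
    linear_combination -h
  · simp

lemma lCoeff_eq_zero (ψ : AddChar F ℂ) (hψ : ψ ≠ 1) {m : ℕ} (hm : 3 ≤ m) : lCoeff ψ m = 0 := by
  obtain ⟨t, ht⟩ := AddChar.ne_one_iff.1 hψ
  have key : lCoeff ψ m = ψ t * lCoeff ψ m := by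
    rw [lCoeff, Finset.mul_sum]
    have aux : ∀ (s : F) (h : F[X]), h ∈ monicPolys F m →
        h + C s * X ^ (m - 1) ∈ monicPolys F m := by
      intro s h hh
      rw [mem_monicPolys] at hh ⊢
      have hd : (C s * X ^ (m - 1)).degree < h.degree := by
        rw [degree_eq_natDegree hh.1.ne_zero, hh.2.1]
        refine (degree_C_mul_X_pow_le _ _).trans_lt ?_
        exact_mod_cast (by omega : m - 1 < m)
      refine ⟨hh.1.add_of_left hd, ?_, ?_⟩
      · rw [natDegree_add_eq_left_of_degree_lt hd, hh.2.1]
      · rw [coeff_add, coeff_C_mul_X_pow, if_neg (by omega), add_zero]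
        exact hh.2.2
    refine Finset.sum_bij' (fun h _ => h + C t * X ^ (m - 1))
      (fun h _ => h + C (-t) * X ^ (m - 1)) (fun h hh => aux t h hh)
      (fun h hh => aux (-t) h hh) (by simp [add_assoc]) (by simp [add_assoc]) ?_
    intro h hh
    have hh' := mem_monicPolys.1 hh
    have hh2 := mem_monicPolys.1 (aux t h hh)
    rw [rootChar, rootChar, ← AddChar.map_add_eq_mul,
      nextCoeff_of_natDegree_pos (by rw [hh'.2.1]; omega), hh'.2.1,
      nextCoeff_of_natDegree_pos (by rw [hh2.2.1]; omega), hh2.2.1]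
    simp only [coeff_add, coeff_C_mul_X_pow]
    rw [if_pos trivial, if_neg (by omega), if_neg (by omega)]
    congr 1
    ring
  have h0 : (1 - ψ t) * lCoeff ψ m = 0 := by linear_combination key
  exact (mul_eq_zero.1 h0).resolve_left (sub_ne_zero.2 (Ne.symm ht))

lemma sum_rootChar_dvd (ψ : AddChar F ℂ) {g : F[X]} (hg : g.Monic) (hg0 : g.coeff 0 ≠ 0)
    {m : ℕ} (hm : g.natDegree ≤ m) [DecidablePred (g ∣ ·)] :
    ∑ h ∈ monicPolys F m with g ∣ h, rootChar ψ h =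
      rootChar ψ g * lCoeff ψ (m - g.natDegree) := by
  rw [lCoeff, Finset.mul_sum]
  symm
  refine Finset.sum_bij (fun h _ => g * h) ?_ ?_ ?_ ?_
  · intro h hh
    rw [mem_monicPolys] at hh
    rw [Finset.mem_filter, mem_monicPolys]
    refine ⟨⟨hg.mul hh.1, ?_, ?_⟩, dvd_mul_right _ _⟩
    · rw [hg.natDegree_mul hh.1, hh.2.1]
      omega
    · rw [mul_coeff_zero]
      exact mul_ne_zero hg0 hh.2.2
  · intro h _ h' _ e
    exact mul_left_cancel₀ hg.ne_zero e
  · intro h hh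
    rw [Finset.mem_filter, mem_monicPolys] at hh
    obtain ⟨⟨h1, h2, h3⟩, k, rfl⟩ := hh
    have hk : k.Monic := hg.of_mul_monic_left h1
    refine ⟨k, ?_, rfl⟩
    rw [mul_coeff_zero] at h3
    rw [hg.natDegree_mul hk] at h2
    exact mem_monicPolys.2 ⟨hk, by omega, right_ne_zero_of_mul h3⟩
  · intro h hh
    rw [mem_monicPolys] at hh
    exact (rootChar_mul ψ hg hh.1 hg0 hh.2.2).symm

end LFunction

section Minpoly
variable {F E : Type*} [Field F] [Field E] [Algebra F E] [FiniteDimensional F E]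

lemma natDegree_minpoly_inv_le {x : E} (hx : x ≠ 0) :
    (minpoly F x⁻¹).natDegree ≤ (minpoly F x).natDegree := by
  have h0 : (minpoly F x).reverse ≠ 0 := by
    rw [Ne, reverse_eq_zero]
    exact minpoly.ne_zero (.of_finite F x)
  refine (natDegree_le_of_dvd (minpoly.dvd F x⁻¹ ?_) h0).trans (reverse_natDegree_le _)
  let := invertibleOfNonzero hx
  have := (eval₂_reverse_eq_zero_iff (algebraMap F E) x (minpoly F x)).2 (minpoly.aeval F x)
  rwa [invOf_eq_inv] at this

lemma natDegree_minpoly_inv {x : E} (hx : x ≠ 0) :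
    (minpoly F x⁻¹).natDegree = (minpoly F x).natDegree :=
  (natDegree_minpoly_inv_le hx).antisymm <| by
    simpa using natDegree_minpoly_inv_le (F := F) (inv_ne_zero hx)

lemma nextCoeff_minpoly_inv {x : E} (hx : x ≠ 0) :
    (minpoly F x⁻¹).nextCoeff = (minpoly F x).coeff 1 / (minpoly F x).coeff 0 := by
  have hxi : IsIntegral F x := .of_finite F x
  have h0 : (minpoly F x).coeff 0 ≠ 0 := minpoly.coeff_zero_ne_zero hxi hx
  have htr : (minpoly F x).natTrailingDegree = 0 :=
    natTrailingDegree_eq_zero.2 (Or.inr h0)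
  have hdeg : (minpoly F x).reverse.natDegree = (minpoly F x).natDegree := by
    rw [reverse_natDegree, htr, Nat.sub_zero]
  have hmonic : (C ((minpoly F x).coeff 0)⁻¹ * (minpoly F x).reverse).Monic := by
    rw [Monic, leadingCoeff_mul, leadingCoeff_C, reverse_leadingCoeff, trailingCoeff, htr,
      inv_mul_cancel₀ h0]
  have hdeg' : (C ((minpoly F x).coeff 0)⁻¹ * (minpoly F x).reverse).natDegree =
      (minpoly F x).natDegree := by
    rw [natDegree_C_mul (inv_ne_zero h0), hdeg]
  have heq : minpoly F x⁻¹ = C ((minpoly F x).coeff 0)⁻¹ * (minpoly F x).reverse := by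
    symm
    refine eq_of_monic_of_dvd_of_natDegree_le (minpoly.monic (.of_finite F _)) hmonic ?_ ?_
    · refine Dvd.dvd.mul_left (minpoly.dvd F x⁻¹ ?_) _
      let := invertibleOfNonzero hx
      have := (eval₂_reverse_eq_zero_iff (algebraMap F E) x (minpoly F x)).2 (minpoly.aeval F x)
      rwa [invOf_eq_inv] at this
    · rw [hdeg', natDegree_minpoly_inv hx]
  have hpos : 0 < (minpoly F x).natDegree := minpoly.natDegree_pos hxi
  rw [heq, nextCoeff_of_natDegree_pos (by rwa [hdeg']), hdeg', coeff_C_mul, coeff_reverse,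
    revAt_le (by omega), show (minpoly F x).natDegree - ((minpoly F x).natDegree - 1) = 1 by omega]
  field_simp

lemma trace_eq_div_mul_nextCoeff (x : E) :
    Algebra.trace F E x = ((Module.finrank F E / (minpoly F x).natDegree : ℕ) : F) *
      -(minpoly F x).nextCoeff := by
  have hxi : IsIntegral F x := .of_finite F x
  have h := Module.finrank_mul_finrank F (IntermediateField.adjoin F {x}) E
  rw [IntermediateField.adjoin.finrank hxi] at h
  rw [trace_eq_finrank_mul_minpoly_nextCoeff, ← h,
    Nat.mul_div_cancel_left _ (minpoly.natDegree_pos hxi)]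

lemma rootChar_minpoly_pow (ψ : AddChar F ℂ) {x : E} (hx : x ≠ 0) :
    rootChar ψ (minpoly F x ^ (Module.finrank F E / (minpoly F x).natDegree)) =
      ψ (Algebra.trace F E (x + x⁻¹)) := by
  have hxi : IsIntegral F x := .of_finite F x
  rw [rootChar_pow ψ (minpoly.monic hxi) (minpoly.coeff_zero_ne_zero hxi hx), map_add,
    trace_eq_div_mul_nextCoeff, trace_eq_div_mul_nextCoeff x⁻¹, natDegree_minpoly_inv hx,
    nextCoeff_minpoly_inv hx, rootChar, ← mul_add, ← nsmul_eq_mul, AddChar.map_nsmul_eq_pow,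
    sub_eq_add_neg]

end Minpoly

section Recursion
open UniqueFactorizationMonoid
variable {F : Type*} [Field F] [DecidableEq F]

open Classical in
/-- The number of elements of the degree `j` extension of `F` whose characteristic polynomial
divides `h`. -/
noncomputable def charpolyDvdCount (h : F[X]) (j : ℕ) : ℕ :=
  ∑ P ∈ (normalizedFactors h).toFinset,
    if P.natDegree ∣ j ∧ P ^ (j / P.natDegree) ∣ h then P.natDegree else 0

lemma sum_charpolyDvdCount {h : F[X]} (hh : h.Monic) :
    ∑ j ∈ Finset.Icc 1 h.natDegree, charpolyDvdCount h j = h.natDegree := by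
  classical
  simp only [charpolyDvdCount]
  rw [Finset.sum_comm]
  have hprod : (normalizedFactors h).prod = h :=
    (prod_normalizedFactors_eq hh.ne_zero).trans (hh.normalize_eq_self)
  have hmon : ∀ P ∈ normalizedFactors h, P.Monic := fun P hP =>
    (Polynomial.mem_normalizedFactors_iff hh.ne_zero).1 hP |>.2.1
  conv_rhs => rw [← hprod, natDegree_multiset_prod_of_monic _ hmon,
    Finset.sum_multiset_map_count]
  refine Finset.sum_congr rfl fun P hP => ?_
  rw [Multiset.mem_toFinset] at hP
  have hirr : Irreducible P := irreducible_of_normalized_factor P hP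
  have hd : 0 < P.natDegree := hirr.natDegree_pos
  have hnorm : normalize P = P := normalize_normalized_factor P hP
  have hpow : ∀ k, P ^ k ∣ h ↔ k ≤ (normalizedFactors h).count P := by
    intro k
    rw [pow_dvd_iff_le_emultiplicity, emultiplicity_eq_count_normalizedFactors hirr hh.ne_zero,
      hnorm]
    exact Nat.cast_le
  rw [← Finset.sum_filter, Finset.sum_const, smul_eq_mul, smul_eq_mul]
  congr 1
  conv_rhs => rw [← Nat.add_sub_cancel (n := (normalizedFactors h).count P) (m := 1),
    ← Nat.card_Icc]
  symm
  refine Finset.card_bij (fun k _ => P.natDegree * k) ?_ ?_ ?_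
  · intro k hk
    rw [Finset.mem_Icc] at hk
    rw [Finset.mem_filter, Finset.mem_Icc, Nat.mul_div_cancel_left _ hd, hpow]
    refine ⟨⟨Nat.mul_pos hd hk.1, ?_⟩, dvd_mul_right _ _, hk.2⟩
    have := natDegree_le_of_dvd ((hpow k).2 hk.2) hh.ne_zero
    rwa [natDegree_pow, mul_comm] at this
  · intro k _ k' _ e
    exact Nat.eq_of_mul_eq_mul_left hd e
  · intro j hj
    rw [Finset.mem_filter, Finset.mem_Icc] at hj
    obtain ⟨hj, ⟨k, rfl⟩, hk⟩ := hj
    rw [Nat.mul_div_cancel_left _ hd, hpow] at hk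
    refine ⟨k, ?_, rfl⟩
    rw [Finset.mem_Icc]
    exact ⟨Nat.pos_of_mul_pos_left hj.1, hk⟩

variable {E : Type*} [Field E] [Algebra F E] [Finite F] [Fintype E]

open Classical in
lemma card_minpoly_eq {P : F[X]} (hP : Irreducible P) (hm : P.Monic)
    (hd : P.natDegree ∣ Module.finrank F E) :
    #{x : E | minpoly F x = P} = P.natDegree := by
  have hsplit : (P.map (algebraMap F E)).Splits := by
    have := (hP.natDegree_dvd_iff_dvd_X_pow_card_pow_sub_X).1 hd
    have hcard : Nat.card F ^ Module.finrank F E = Fintype.card E := by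
      rw [← Module.natCard_eq_pow_finrank, Nat.card_eq_fintype_card]
    rw [hcard] at this
    exact (FiniteField.isSplittingField_sub E F).splits.of_dvd
      (by simpa using FiniteField.X_pow_card_sub_X_ne_zero E Fintype.one_lt_card)
      (Polynomial.map_dvd (algebraMap F E) this)
  rw [← card_rootSet_eq_natDegree (PerfectField.separable_of_irreducible hP) hsplit,
    ← Set.toFinset_card]
  congr 1
  ext x
  rw [Finset.mem_filter, Set.mem_toFinset, mem_rootSet]
  constructor
  · rintro ⟨-, rfl⟩
    exact ⟨hP.ne_zero, minpoly.aeval F x⟩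
  · rintro ⟨-, h⟩
    exact ⟨Finset.mem_univ _, (minpoly.eq_of_irreducible_of_monic hP h hm).symm⟩

open Classical in
lemma card_charpoly_dvd {h : F[X]} (hh : h.Monic) :
    #{x : E | minpoly F x ^ (Module.finrank F E / (minpoly F x).natDegree) ∣ h} =
      charpolyDvdCount h (Module.finrank F E) := by
  have hfd : FiniteDimensional F E := Module.Finite.of_finite
  have hdiv : ∀ x : E, (minpoly F x).natDegree ∣ Module.finrank F E := fun x =>
    minpoly.degree_dvd (.of_finite F x)
  have hmaps : ∀ x ∈ ({x : E | minpoly F x ^ (Module.finrank F E / (minpoly F x).natDegree) ∣ h}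
      : Finset E), minpoly F x ∈ (normalizedFactors h).toFinset := by
    intro x hx
    rw [Finset.mem_filter] at hx
    rw [Multiset.mem_toFinset, Polynomial.mem_normalizedFactors_iff hh.ne_zero]
    refine ⟨minpoly.irreducible (.of_finite F x), minpoly.monic (.of_finite F x),
      (dvd_pow_self _ ?_).trans hx.2⟩
    exact (Nat.div_pos (Nat.le_of_dvd Module.finrank_pos (hdiv x))
      (minpoly.natDegree_pos (.of_finite F x))).ne'
  rw [Finset.card_eq_sum_card_fiberwise hmaps, charpolyDvdCount]
  refine Finset.sum_congr rfl fun P hP => ?_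
  rw [Multiset.mem_toFinset, Polynomial.mem_normalizedFactors_iff hh.ne_zero] at hP
  split_ifs with hc
  · rw [← card_minpoly_eq (E := E) hP.1 hP.2.1 hc.1]
    congr 1
    ext x
    simp only [Finset.mem_filter, Finset.mem_univ, true_and, and_iff_right_iff_imp]
    rintro rfl
    exact hc.2
  · rw [Finset.card_eq_zero, Finset.eq_empty_iff_forall_notMem]
    intro x hx
    simp only [Finset.mem_filter, Finset.mem_univ, true_and] at hx
    obtain ⟨hx, rfl⟩ := hx
    exact hc ⟨hdiv x, hx⟩

end Recursion

section TraceChar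
variable {F E : Type*} [Field F] [Field E] [Algebra F E]

variable (E) in
/-- The additive character `ψ ∘ Tr` of an extension `E` of `F`. -/
noncomputable def traceChar (ψ : AddChar F ℂ) : AddChar E ℂ :=
  ψ.compAddMonoidHom (Algebra.trace F E).toAddMonoidHom

lemma traceChar_apply (ψ : AddChar F ℂ) (x : E) : traceChar E ψ x = ψ (Algebra.trace F E x) := rfl

variable [DecidableEq F] [Fintype F] [Fintype E] [DecidableEq E]

lemma sum_rootChar_mul_charpolyDvdCount (ψ : AddChar F ℂ) {m : ℕ} (hm : Module.finrank F E ≤ m) :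
    ∑ h ∈ monicPolys F m, rootChar ψ h * charpolyDvdCount h (Module.finrank F E) =
      kloostermanSum (traceChar E ψ) * lCoeff ψ (m - Module.finrank F E) := by
  classical
  have hfd : FiniteDimensional F E := Module.Finite.of_finite
  set π : E → F[X] :=
    fun x => minpoly F x ^ (Module.finrank F E / (minpoly F x).natDegree) with hπ
  have hdiv : ∀ x : E, (minpoly F x).natDegree ∣ Module.finrank F E := fun x =>
    minpoly.degree_dvd (.of_finite F x)
  have hcoeff : ∀ x : E, (π x).coeff 0 =
      (minpoly F x).coeff 0 ^ (Module.finrank F E / (minpoly F x).natDegree) := by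
    intro x
    rw [hπ, coeff_zero_eq_eval_zero, eval_pow, ← coeff_zero_eq_eval_zero]
  have hinner : ∀ x : E, ∑ h ∈ monicPolys F m with π x ∣ h, rootChar ψ h =
      if x = 0 then 0 else
        traceChar E ψ (x + x⁻¹) * lCoeff ψ (m - Module.finrank F E) := by
    intro x
    split_ifs with hx
    · refine Finset.sum_eq_zero fun h hh => ?_
      rw [Finset.mem_filter, mem_monicPolys] at hh
      refine absurd ?_ hh.1.2.2
      obtain ⟨k, rfl⟩ := hh.2
      rw [mul_coeff_zero, hcoeff, hx, minpoly.zero, coeff_X_zero, natDegree_X, Nat.div_one,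
        zero_pow Module.finrank_pos.ne', zero_mul]
    · have hdeg : (π x).natDegree = Module.finrank F E := by
        rw [hπ, natDegree_pow, Nat.div_mul_cancel (hdiv x)]
      rw [sum_rootChar_dvd ψ ((minpoly.monic (.of_finite F x)).pow _) _ (by rwa [hdeg]), hdeg,
        rootChar_minpoly_pow ψ hx, traceChar_apply]
      rw [hcoeff]
      exact pow_ne_zero _ (minpoly.coeff_zero_ne_zero (.of_finite F x) hx)
  calc _ = ∑ h ∈ monicPolys F m, ∑ x : E with π x ∣ h, rootChar ψ h := by
        refine Finset.sum_congr rfl fun h hh => ?_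
        rw [← card_charpoly_dvd (E := E) (mem_monicPolys.1 hh).1, Finset.sum_const, nsmul_eq_mul,
          mul_comm]
    _ = ∑ x : E, ∑ h ∈ monicPolys F m with π x ∣ h, rootChar ψ h := by
        simp_rw [Finset.sum_filter]
        exact Finset.sum_comm
    _ = _ := by
        simp_rw [hinner]
        rw [kloostermanSum, Finset.sum_mul]
        symm
        refine Finset.sum_of_injOn (fun u : Eˣ => (u : E)) Units.val_injective.injOn
          (by simp) ?_ ?_
        · intro x _ hx
          rw [if_pos]
          by_contra h
          exact hx ⟨Units.mk0 x h, by simp, rfl⟩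
        · intro u _
          rw [if_neg u.ne_zero]

end TraceChar

section PowerSums
variable {F : Type*} [Field F] [Fintype F] [DecidableEq F]

/-- The Kloosterman sum over the extension of degree `j`, expressed through polynomials. -/
noncomputable def kloostermanPowerSum (ψ : AddChar F ℂ) (j : ℕ) : ℂ :=
  ∑ h ∈ monicPolys F j, rootChar ψ h * charpolyDvdCount h j

lemma kloostermanSum_traceChar {E : Type*} [Field E] [Algebra F E] [Fintype E] [DecidableEq E]
    (ψ : AddChar F ℂ) :
    kloostermanSum (traceChar E ψ) = kloostermanPowerSum ψ (Module.finrank F E) := by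
  rw [kloostermanPowerSum, sum_rootChar_mul_charpolyDvdCount ψ le_rfl, Nat.sub_self, lCoeff_zero,
    mul_one]

lemma sum_rootChar_mul_charpolyDvdCount' (ψ : AddChar F ℂ) {j m : ℕ} (hj : 0 < j) (hm : j ≤ m) :
    ∑ h ∈ monicPolys F m, rootChar ψ h * charpolyDvdCount h j =
      kloostermanPowerSum ψ j * lCoeff ψ (m - j) := by
  classical
  have : Fact (ringChar F).Prime := ⟨CharP.char_is_prime F _⟩
  have : NeZero j := ⟨hj.ne'⟩
  have : Fintype (FiniteField.Extension F (ringChar F) j) := Fintype.ofFinite _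
  have h := sum_rootChar_mul_charpolyDvdCount (E := FiniteField.Extension F (ringChar F) j) ψ
    (m := m) (by rwa [FiniteField.finrank_extension])
  rwa [kloostermanSum_traceChar, FiniteField.finrank_extension] at h

lemma mul_lCoeff (ψ : AddChar F ℂ) (m : ℕ) :
    m * lCoeff ψ m = ∑ j ∈ Finset.Icc 1 m, kloostermanPowerSum ψ j * lCoeff ψ (m - j) := by
  calc _ = ∑ h ∈ monicPolys F m, rootChar ψ h *
        ((∑ j ∈ Finset.Icc 1 m, charpolyDvdCount h j : ℕ) : ℂ) := by
        rw [lCoeff, Finset.mul_sum]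
        refine Finset.sum_congr rfl fun h hh => ?_
        rw [mem_monicPolys] at hh
        rw [← hh.2.1, sum_charpolyDvdCount hh.1, mul_comm]
    _ = ∑ j ∈ Finset.Icc 1 m, ∑ h ∈ monicPolys F m, rootChar ψ h * charpolyDvdCount h j := by
        rw [Finset.sum_comm]
        simp_rw [Nat.cast_sum, Finset.mul_sum]
    _ = _ := by
        refine Finset.sum_congr rfl fun j hj => ?_
        rw [Finset.mem_Icc] at hj
        exact sum_rootChar_mul_charpolyDvdCount' ψ hj.1 hj.2

lemma kloostermanPowerSum_eq (ψ : AddChar F ℂ) (hψ : ψ ≠ 1) {α β : ℂ}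
    (hadd : α + β = -kloostermanSum ψ) (hmul : α * β = Fintype.card F) {m : ℕ} (hm : 0 < m) :
    kloostermanPowerSum ψ m = -(α ^ m + β ^ m) := by
  have h1 : kloostermanPowerSum ψ 1 = kloostermanSum ψ := by
    have := mul_lCoeff ψ 1
    simpa [lCoeff_zero, lCoeff_one] using this.symm
  have h2 : kloostermanPowerSum ψ 2 + kloostermanPowerSum ψ 1 * kloostermanSum ψ =
      2 * Fintype.card F := by
    have := mul_lCoeff ψ 2
    rw [Finset.sum_Icc_succ_top (by norm_num), Finset.Icc_self, Finset.sum_singleton] at this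
    norm_num [lCoeff_zero, lCoeff_one, lCoeff_two ψ hψ] at this
    linear_combination -this
  have hrec : ∀ k, kloostermanPowerSum ψ (k + 3) + kloostermanPowerSum ψ (k + 2) *
      kloostermanSum ψ + kloostermanPowerSum ψ (k + 1) * Fintype.card F = 0 := by
    intro k
    have := mul_lCoeff ψ (k + 3)
    rw [lCoeff_eq_zero ψ hψ (by omega), Finset.sum_Icc_succ_top (by omega),
      Finset.sum_Icc_succ_top (by omega), Finset.sum_Icc_succ_top (by omega),
      Finset.sum_eq_zero] at this
    · rw [show k + 3 - (k + 2 + 1) = 0 by omega, show k + 3 - (k + 1 + 1) = 1 by omega,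
        show k + 3 - (k + 1) = 2 by omega, lCoeff_zero, lCoeff_one, lCoeff_two ψ hψ] at this
      linear_combination -this
    · intro j hj
      rw [Finset.mem_Icc] at hj
      rw [lCoeff_eq_zero ψ hψ (by omega), mul_zero]
  have hK : kloostermanSum ψ = -(α + β) := by rw [hadd, neg_neg]
  rw [hK] at h1 h2 hrec
  rw [← hmul] at h2 hrec
  obtain ⟨k, rfl⟩ := Nat.exists_eq_add_of_le' hm
  rw [Nat.succ_eq_add_one, zero_add]
  clear hm
  induction k using Nat.strong_induction_on with
  | _ k ih =>
    match k with
    | 0 => rw [h1]; ring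
    | 1 => rw [h1] at h2; linear_combination h2
    | k + 2 =>
      have e1 := ih k (by omega)
      have e2 := ih (k + 1) (by omega)
      have := hrec k
      rw [e1, show k + 2 = k + 1 + 1 from rfl, e2] at this
      rw [show k + 2 + 1 = k + 3 from rfl]
      linear_combination this

omit [Field F] [Fintype F] [DecidableEq F] in
lemma norm_sq_le_of_power_sum_bound {α β : ℂ} {q : ℝ} (hq : 0 < q) (hmul : ‖α‖ * ‖β‖ = q)
    {B : ℝ} {s₀ : ℕ} (h : ∀ s ≥ s₀, ‖α ^ (2 * s) + β ^ (2 * s)‖ ≤ B * q ^ s) : ‖α‖ ^ 2 ≤ q := by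
  by_contra! hlt
  have hα : 0 < ‖α‖ := by
    by_contra! h0
    have : ‖α‖ = 0 := le_antisymm h0 (norm_nonneg _)
    rw [this, zero_mul] at hmul
    exact hq.ne hmul
  have hβ : ‖β‖ ^ 2 ≤ q := by
    by_contra! h'
    have : q * q < ‖α‖ ^ 2 * ‖β‖ ^ 2 := by gcongr
    rw [← mul_pow, hmul] at this
    nlinarith
  have hρ : 1 < ‖α‖ ^ 2 / q := by rwa [one_lt_div hq]
  obtain ⟨s, hs, hs'⟩ := (((tendsto_pow_atTop_atTop_of_one_lt hρ).eventually_gt_atTop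
    (B + 1)).and (Filter.eventually_ge_atTop s₀)).exists
  have h1 := h s hs'
  have h2 : ‖α‖ ^ (2 * s) - ‖β‖ ^ (2 * s) ≤ ‖α ^ (2 * s) + β ^ (2 * s)‖ := by
    have := norm_sub_le (α ^ (2 * s) + β ^ (2 * s)) (β ^ (2 * s))
    rw [add_sub_cancel_right, norm_pow, norm_pow] at this
    linarith
  have h3 : ‖β‖ ^ (2 * s) ≤ q ^ s := by
    rw [pow_mul]
    gcongr
  rw [div_pow, lt_div_iff₀ (by positivity), ← pow_mul] at hs
  nlinarith

lemma norm_kloostermanSum_le_of_power_sum_bound (ψ : AddChar F ℂ) (hψ : ψ ≠ 1) {B : ℝ} {s₀ : ℕ}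
    (h : ∀ s ≥ s₀, ‖kloostermanPowerSum ψ (2 * s)‖ ≤ B * (Fintype.card F : ℝ) ^ s) :
    ‖kloostermanSum ψ‖ ≤ 2 * √(Fintype.card F) := by
  obtain ⟨δ, hδ⟩ := IsAlgClosed.exists_pow_nat_eq
    (kloostermanSum ψ ^ 2 - 4 * (Fintype.card F : ℂ)) two_pos
  set α := (-kloostermanSum ψ + δ) / 2 with hα
  set β := (-kloostermanSum ψ - δ) / 2 with hβ
  have hadd : α + β = -kloostermanSum ψ := by rw [hα, hβ]; ring
  have hmul : α * β = Fintype.card F := by rw [hα, hβ]; linear_combination -hδ / 4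
  have hq : (0 : ℝ) < Fintype.card F := by exact_mod_cast Fintype.card_pos
  have hn : ‖α‖ * ‖β‖ = Fintype.card F := by rw [← norm_mul, hmul]; simp
  have h' : ∀ s ≥ max s₀ 1, ‖α ^ (2 * s) + β ^ (2 * s)‖ ≤ B * (Fintype.card F : ℝ) ^ s := by
    intro s hs
    have := h s (le_of_max_le_left hs)
    rwa [kloostermanPowerSum_eq ψ hψ hadd hmul (by have := le_of_max_le_right hs; omega),
      norm_neg] at this
  have hαq := Real.le_sqrt_of_sq_le (norm_sq_le_of_power_sum_bound hq hn h')
  have hβq := Real.le_sqrt_of_sq_le (norm_sq_le_of_power_sum_bound hq (by rwa [mul_comm])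
    (fun s hs => by rw [add_comm]; exact h' s hs))
  rw [← norm_neg, ← hadd]
  linarith [norm_add_le α β]

end PowerSums

section CoordinateRing
open QuadraticAlgebra

variable (F : Type*) [Field F] [Fintype F]

/-- The coordinate ring `F[y][x] / (x² - (y ^ q - y) x + 1)` of the Artin–Schreier curve
`y ^ q - y = x + x⁻¹`, where `q = #F`. -/
abbrev KloostermanRing : Type _ :=
  QuadraticAlgebra F[X] (-1) (X ^ Fintype.card F - X)

namespace KloostermanRing
variable {F}

/-- The inverse of the coordinate function `x`. -/
noncomputable def omegaInv : KloostermanRing F := ⟨X ^ Fintype.card F - X, -1⟩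

lemma omega_mul_omegaInv : (ω : KloostermanRing F) * omegaInv = 1 := by
  ext <;> simp [omegaInv]

/-- The functions with poles of order at most `D` at the two points at infinity. -/
def PoleLE (D : ℕ) (h : KloostermanRing F) : Prop :=
  h.re.degree ≤ D ∧ h.im.degree + (Fintype.card F : ℕ) ≤ (D : WithBot ℕ)

lemma degree_X_pow_card_sub_X_le : (X ^ Fintype.card F - X : F[X]).degree ≤ Fintype.card F :=
  natDegree_le_iff_degree_le.1
    (FiniteField.X_pow_card_sub_X_natDegree_eq F Fintype.one_lt_card).le

namespace PoleLE
variable {D D' : ℕ} {g h : KloostermanRing F}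

lemma mono (hh : PoleLE D h) (hD : D ≤ D') : PoleLE D' h :=
  ⟨hh.1.trans (by exact_mod_cast hD), hh.2.trans (by exact_mod_cast hD)⟩

lemma zero : PoleLE D (0 : KloostermanRing F) := by
  simp [PoleLE]

lemma add (hg : PoleLE D g) (hh : PoleLE D h) : PoleLE D (g + h) := by
  refine ⟨(degree_add_le _ _).trans (max_le hg.1 hh.1), ?_⟩
  rw [im_add]
  rcases le_total g.im.degree h.im.degree with hle | hle
  · exact (add_le_add_left ((degree_add_le _ _).trans (max_le hle le_rfl)) _).trans hh.2
  · exact (add_le_add_left ((degree_add_le _ _).trans (max_le le_rfl hle)) _).trans hg.2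

lemma smul (a : F) (hh : PoleLE D h) : PoleLE D (a • h) :=
  ⟨(degree_smul_le _ _).trans hh.1,
    (add_le_add_left (degree_smul_le _ _) _).trans hh.2⟩

lemma sum {ι : Type*} {s : Finset ι} {f : ι → KloostermanRing F}
    (hf : ∀ i ∈ s, PoleLE D (f i)) : PoleLE D (∑ i ∈ s, f i) := by
  classical
  induction s using Finset.induction_on with
  | empty => exact zero
  | insert i s hi ih =>
    rw [Finset.sum_insert hi]
    exact (hf i (Finset.mem_insert_self _ _)).add
      (ih fun j hj => hf j (Finset.mem_insert_of_mem hj))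

lemma mul (hg : PoleLE D g) (hh : PoleLE D' h) : PoleLE (D + D') (g * h) := by
  obtain ⟨g1, g2⟩ := hg
  obtain ⟨h1, h2⟩ := hh
  have hq : (0 : WithBot ℕ) ≤ (Fintype.card F : ℕ) := by exact_mod_cast Nat.zero_le _
  have hg2 : g.im.degree ≤ D := (le_add_of_nonneg_right hq).trans g2
  have hh2 : h.im.degree ≤ D' := (le_add_of_nonneg_right hq).trans h2
  constructor
  · rw [re_mul, Nat.cast_add]
    refine (degree_add_le _ _).trans (max_le ?_ ?_)
    · exact (degree_mul_le _ _).trans (add_le_add g1 h1)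
    · rw [mul_assoc, neg_one_mul, degree_neg]
      exact (degree_mul_le _ _).trans (add_le_add hg2 hh2)
  · have e1 : (g.re * h.im).degree + (Fintype.card F : ℕ) ≤ (D : WithBot ℕ) + D' := by
      rw [degree_mul, add_assoc]
      exact add_le_add g1 h2
    have e2 : (g.im * h.re).degree + (Fintype.card F : ℕ) ≤ (D : WithBot ℕ) + D' := by
      rw [degree_mul, add_right_comm]
      exact add_le_add g2 h1
    have e3 : ((X ^ Fintype.card F - X) * g.im * h.im).degree + (Fintype.card F : ℕ) ≤
        (D : WithBot ℕ) + D' := by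
      rw [degree_mul, degree_mul]
      calc _ ≤ ((Fintype.card F : ℕ) : WithBot ℕ) + g.im.degree + h.im.degree
            + (Fintype.card F : ℕ) := by
              gcongr
              exact degree_X_pow_card_sub_X_le
        _ = (g.im.degree + (Fintype.card F : ℕ)) + (h.im.degree + (Fintype.card F : ℕ)) := by
              ac_rfl
        _ ≤ _ := add_le_add g2 h2
    rw [im_mul, Nat.cast_add]
    have aux : ∀ {a b : F[X]} {B : WithBot ℕ}, a.degree + (Fintype.card F : ℕ) ≤ B →
        b.degree + (Fintype.card F : ℕ) ≤ B → (a + b).degree + (Fintype.card F : ℕ) ≤ B := by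
      intro a b B ha hb
      rcases le_total a.degree b.degree with hle | hle
      · exact (add_le_add_left ((degree_add_le _ _).trans (max_le hle le_rfl)) _).trans hb
      · exact (add_le_add_left ((degree_add_le _ _).trans (max_le le_rfl hle)) _).trans ha
    exact aux (aux e1 e2) e3

lemma one : PoleLE 0 (1 : KloostermanRing F) := by
  simp [PoleLE]

lemma pow (hh : PoleLE D h) (n : ℕ) : PoleLE (n * D) (h ^ n) := by
  induction n with
  | zero => simpa using one
  | succ n ih =>
    rw [pow_succ, add_mul, one_mul]
    exact ih.mul hh

lemma omega : PoleLE (Fintype.card F) (ω : KloostermanRing F) := by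
  simp [PoleLE]

lemma omegaInv : PoleLE (Fintype.card F) (omegaInv : KloostermanRing F) := by
  refine ⟨degree_X_pow_card_sub_X_le, ?_⟩
  simp [KloostermanRing.omegaInv]

lemma algebraMap {p : F[X]} (hp : p.natDegree ≤ D) :
    PoleLE D (algebraMap F[X] (KloostermanRing F) p) := by
  refine ⟨natDegree_le_iff_degree_le.1 hp, ?_⟩
  simp

end PoleLE

/-- The functions `x ^ (i - A) * y ^ j`, with `y` translated by `c`. -/
noncomputable def mono (c : F) (A i j : ℕ) : KloostermanRing F :=
  ω ^ i * omegaInv ^ A * algebraMap F[X] (KloostermanRing F) ((X + C c) ^ j)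

lemma poleLE_mono (c : F) {A i j : ℕ} (hi : i < 2 * A + 1) (hj : j < Fintype.card F) :
    PoleLE (Fintype.card F * (A + 1)) (mono c A i j) := by
  rw [Nat.mul_add, mul_one]
  refine PoleLE.mul ?_ (PoleLE.algebraMap ?_)
  · rcases le_total i A with h | h
    · obtain ⟨k, rfl⟩ := Nat.exists_eq_add_of_le h
      rw [pow_add, ← mul_assoc, ← mul_pow, omega_mul_omegaInv, one_pow, one_mul]
      refine (PoleLE.omegaInv.pow k).mono ?_
      rw [mul_comm]
      gcongr
      omega
    · obtain ⟨k, rfl⟩ := Nat.exists_eq_add_of_le h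
      rw [pow_add, mul_right_comm, ← mul_pow, omega_mul_omegaInv, one_pow, one_mul]
      refine (PoleLE.omega.pow k).mono ?_
      rw [mul_comm]
      gcongr
      omega
  · rw [natDegree_pow, natDegree_X_add_C]
    omega

lemma im_omega_pow (n : ℕ) : (ω ^ (n + 1) : KloostermanRing F).im.Monic ∧
    (ω ^ (n + 1) : KloostermanRing F).im.natDegree = Fintype.card F * n ∧
    (ω ^ n : KloostermanRing F).im.degree < (ω ^ (n + 1) : KloostermanRing F).im.degree := by
  have hw : (X ^ Fintype.card F - X : F[X]).Monic :=
    monic_X_pow_sub (by rw [degree_X]; exact_mod_cast Fintype.one_lt_card)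
  have hwd : (X ^ Fintype.card F - X : F[X]).natDegree = Fintype.card F :=
    FiniteField.X_pow_card_sub_X_natDegree_eq F Fintype.one_lt_card
  induction n with
  | zero => simp
  | succ n ih =>
    obtain ⟨h1, h2, h3⟩ := ih
    have hrec : (ω ^ (n + 1 + 1) : KloostermanRing F).im =
        (X ^ Fintype.card F - X) * (ω ^ (n + 1) : KloostermanRing F).im -
          (ω ^ n : KloostermanRing F).im := by
      rw [pow_succ, im_mul, pow_succ ω n, re_mul, omega_re, omega_im]
      ring
    have hlt : (ω ^ (n + 1) : KloostermanRing F).im.degree <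
        ((X ^ Fintype.card F - X) * (ω ^ (n + 1) : KloostermanRing F).im).degree := by
      rw [degree_eq_natDegree h1.ne_zero, degree_eq_natDegree (hw.mul h1).ne_zero,
        hw.natDegree_mul h1, hwd]
      exact_mod_cast Nat.lt_add_of_pos_left Fintype.card_pos
    rw [hrec]
    have hlt' := h3.trans hlt
    refine ⟨(hw.mul h1).sub_of_left hlt', ?_, ?_⟩
    · rw [natDegree_eq_of_degree_eq (degree_sub_eq_left_of_degree_lt hlt'),
        hw.natDegree_mul h1, hwd, h2]
      ring
    · rwa [degree_sub_eq_left_of_degree_lt hlt']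

omit [Fintype F] in
lemma sum_smul_ne_zero_of_monic {ι : Type*} [Fintype ι] {p : ι → F[X]} (hp : ∀ k, (p k).Monic)
    (hinj : Function.Injective fun k => (p k).natDegree) {a : ι → F} (ha : a ≠ 0) :
    ∑ k, a k • p k ≠ 0 := by
  classical
  intro h
  have hne : (Finset.univ.filter fun k => a k ≠ 0).Nonempty := by
    obtain ⟨k, hk⟩ := Function.ne_iff.1 ha
    exact ⟨k, by simpa using hk⟩
  obtain ⟨k, hk, hmax⟩ := Finset.exists_max_image _ (fun k => (p k).natDegree) hne
  rw [Finset.mem_filter] at hk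
  have h' := congr_arg (fun f => f.coeff (p k).natDegree) h
  simp only [finsetSum_coeff, coeff_smul, coeff_zero, smul_eq_mul] at h'
  rw [Finset.sum_eq_single k] at h'
  · rw [(hp k).coeff_natDegree, mul_one] at h'
    exact hk.2 h'
  · intro l _ hl
    by_cases hal : a l = 0
    · rw [hal, zero_mul]
    · rw [coeff_eq_zero_of_natDegree_lt, mul_zero]
      exact lt_of_le_of_ne (hmax l (by simpa using hal)) fun h => hl (hinj h)
  · simp

/-- The index set of the auxiliary functions in Stepanov's method. -/
abbrev StepanovIndex (q A A' : ℕ) : Type :=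
  (Fin (2 * A + 1) × Fin q) × (Fin (2 * A' + 1) × Fin q)

/-- Stepanov's auxiliary function with coefficients `a`. -/
noncomputable def auxFun (r A A' : ℕ) (a : StepanovIndex (Fintype.card F) A A' → F) :
    KloostermanRing F :=
  ∑ k, a k • (mono 0 A k.1.1 k.1.2 * mono 0 A' k.2.1 k.2.2 ^ r)

/-- The transform of Stepanov's auxiliary function on the locus where `y ^ (r ^ 2) = y + c`. -/
noncomputable def auxTransform (r A A' : ℕ) (c : F) :
    (StepanovIndex (Fintype.card F) A A' → F) →ₗ[F] KloostermanRing F :=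
  ∑ k, (LinearMap.proj k).smulRight (mono 0 A k.1.1 k.1.2 ^ r * mono c A' k.2.1 k.2.2)

lemma auxTransform_apply (r A A' : ℕ) (c : F) (a : StepanovIndex (Fintype.card F) A A' → F) :
    auxTransform r A A' c a = ∑ k, a k • (mono 0 A k.1.1 k.1.2 ^ r * mono c A' k.2.1 k.2.2) := by
  simp [auxTransform]

lemma poleLE_auxFun (r A A' : ℕ) (a : StepanovIndex (Fintype.card F) A A' → F) :
    PoleLE (Fintype.card F * (A + 1) + r * (Fintype.card F * (A' + 1))) (auxFun r A A' a) :=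
  PoleLE.sum fun k _ => ((poleLE_mono 0 k.1.1.2 k.1.2.2).mul
    ((poleLE_mono 0 k.2.1.2 k.2.2.2).pow r)).smul _

lemma poleLE_auxTransform (r A A' : ℕ) (c : F) (a : StepanovIndex (Fintype.card F) A A' → F) :
    PoleLE (r * (Fintype.card F * (A + 1)) + Fintype.card F * (A' + 1))
      (auxTransform r A A' c a) := by
  rw [auxTransform_apply]
  exact PoleLE.sum fun k _ => (((poleLE_mono 0 k.1.1.2 k.1.2.2).pow r).mul
    (poleLE_mono c k.2.1.2 k.2.2.2)).smul _

lemma omega_pow_mul_mono (A i j : ℕ) : (ω : KloostermanRing F) ^ A * mono 0 A i j =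
    ω ^ i * algebraMap F[X] (KloostermanRing F) (X ^ j) := by
  rw [mono, C_0, add_zero]
  have : (ω : KloostermanRing F) ^ A * omegaInv ^ A = 1 := by
    rw [← mul_pow, omega_mul_omegaInv, one_pow]
  linear_combination ω ^ i * algebraMap F[X] (KloostermanRing F) (X ^ j) * this

omit [Fintype F] [Field F] in
lemma pow_mul_mul_pow_eq {R : Type*} [CommRing R] {w m m' p p' : R} {A A' i i' r : ℕ}
    (h : w ^ A * m = w ^ i * p) (h' : w ^ A' * m' = w ^ i' * p') :
    w ^ (A + A' * r + 1) * (m * m' ^ r) = w ^ (i + r * i' + 1) * (p * p' ^ r) := by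
  calc _ = w * (w ^ A * m) * (w ^ A' * m') ^ r := by ring
    _ = _ := by rw [h, h']; ring

lemma auxFun_ne_zero {r A A' : ℕ} (hr : Fintype.card F * (2 * A + 1) ≤ r)
    {a : StepanovIndex (Fintype.card F) A A' → F} (ha : a ≠ 0) : auxFun r A A' a ≠ 0 := by
  intro h
  have key : (ω ^ (A + A' * r + 1) * auxFun r A A' a).im =
      ∑ k, a k • ((ω ^ ((k.1.1 : ℕ) + r * k.2.1 + 1) : KloostermanRing F).im *
        X ^ ((k.1.2 : ℕ) + r * k.2.2)) := by
    rw [auxFun, Finset.mul_sum, ← imₗ_apply, map_sum]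
    refine Finset.sum_congr rfl fun k _ => ?_
    rw [imₗ_apply]
    have : (ω ^ (A + A' * r + 1) * (a k • (mono 0 A k.1.1 k.1.2 * mono 0 A' k.2.1 k.2.2 ^ r)) :
        KloostermanRing F) = a k • (ω ^ ((k.1.1 : ℕ) + r * k.2.1 + 1) *
          algebraMap F[X] (KloostermanRing F) (X ^ ((k.1.2 : ℕ) + r * k.2.2))) := by
      rw [mul_smul_comm, pow_add X, pow_mul' X, map_mul, map_pow _ (X ^ (k.2.2 : ℕ))]
      exact congr_arg _ (pow_mul_mul_pow_eq (omega_pow_mul_mono A k.1.1 k.1.2)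
        (omega_pow_mul_mono A' k.2.1 k.2.2))
    rw [this, im_smul, im_mul]
    simp [-map_pow]
  rw [h, mul_zero, im_zero] at key
  refine sum_smul_ne_zero_of_monic (fun k => (im_omega_pow _).1.mul (monic_X_pow _)) ?_ ha key.symm
  intro k l hkl
  simp only [(im_omega_pow _).1.natDegree_mul (monic_X_pow _), (im_omega_pow _).2.1,
    natDegree_X_pow] at hkl
  obtain ⟨⟨⟨i, hi⟩, ⟨j, hj⟩⟩, ⟨i', hi'⟩, ⟨j', hj'⟩⟩ := k
  obtain ⟨⟨⟨u, hu⟩, ⟨v, hv⟩⟩, ⟨u', hu'⟩, ⟨v', hv'⟩⟩ := l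
  have aux : ∀ {m d d' e e' : ℕ}, d < m → d' < m → d + m * e = d' + m * e' →
      d = d' ∧ e = e' := by
    intro m d d' e e' hd hd' h
    have h1 := congr_arg (· % m) h
    simp only [Nat.add_mul_mod_self_left, Nat.mod_eq_of_lt hd, Nat.mod_eq_of_lt hd'] at h1
    subst h1
    exact ⟨rfl, Nat.eq_of_mul_eq_mul_left (by omega) (Nat.add_left_cancel h)⟩
  have bound : ∀ {i j : ℕ}, i < 2 * A + 1 → j < Fintype.card F → j + Fintype.card F * i < r := by
    intro i j hi hj
    calc _ < Fintype.card F + Fintype.card F * i := by omega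
      _ = Fintype.card F * (i + 1) := by ring
      _ ≤ Fintype.card F * (2 * A + 1) := Nat.mul_le_mul_left _ hi
      _ ≤ r := hr
  dsimp only at hkl
  obtain ⟨h1, h2⟩ := aux (bound hi hj) (bound hu hv)
    (show j + Fintype.card F * i + r * (j' + Fintype.card F * i') =
      v + Fintype.card F * u + r * (v' + Fintype.card F * u') by linear_combination hkl)
  obtain ⟨rfl, rfl⟩ := aux hj hv h1
  obtain ⟨rfl, rfl⟩ := aux hj' hv' h2
  rfl

lemma exists_auxTransform_eq_zero {r A A' D : ℕ} (c : F)
    (hD : r * (Fintype.card F * (A + 1)) + Fintype.card F * (A' + 1) = D)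
    (hlt : 2 * (D + 1) < Fintype.card F +
      (2 * A + 1) * Fintype.card F * ((2 * A' + 1) * Fintype.card F)) :
    ∃ a : StepanovIndex (Fintype.card F) A A' → F, a ≠ 0 ∧ auxTransform r A A' c a = 0 := by
  let L : (StepanovIndex (Fintype.card F) A A' → F) →ₗ[F]
      (Fin (D + 1) ⊕ Fin (D + 1 - Fintype.card F) → F) := LinearMap.pi (Sum.elim
    (fun j => lcoeff F (j : Fin _) ∘ₗ (reₗ _ _).restrictScalars F ∘ₗ auxTransform r A A' c)
    (fun j => lcoeff F (j : Fin _) ∘ₗ (imₗ _ _).restrictScalars F ∘ₗ auxTransform r A A' c))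
  have hqD : Fintype.card F ≤ D :=
    by
    have := Nat.le_mul_of_pos_right (Fintype.card F) (Nat.succ_pos A')
    rw [Nat.succ_eq_add_one] at this
    omega
  have hker : L.ker ≠ ⊥ := by
    apply LinearMap.ker_ne_bot_of_finrank_lt
    simp only [Module.finrank_pi, Fintype.card_sum, Fintype.card_prod, Fintype.card_fin]
    omega
  obtain ⟨a, ha, ha0⟩ := Submodule.exists_mem_ne_zero_of_ne_bot hker
  refine ⟨a, ha0, ?_⟩
  rw [LinearMap.mem_ker] at ha
  have hpole := poleLE_auxTransform r A A' c a
  rw [hD] at hpole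
  ext j
  · by_cases hj : j < D + 1
    · exact congr_fun ha (Sum.inl ⟨j, hj⟩)
    · rw [coeff_eq_zero_of_degree_lt (hpole.1.trans_lt (by exact_mod_cast (by omega)))]
      simp
  · by_cases hj : j < D + 1 - Fintype.card F
    · exact congr_fun ha (Sum.inr ⟨j, hj⟩)
    · rw [coeff_eq_zero_of_degree_lt]
      · simp
      · by_contra! hle
        have := (add_le_add_left hle _).trans hpole.2
        norm_cast at this
        omega

section Evaluation
variable {Ω : Type*} [Field Ω] [Algebra F Ω]

/-- Evaluation of functions at the point `(x, y)`. -/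
noncomputable def evalHom {x y : Ω} (h : x * x = (y ^ Fintype.card F - y) * x - 1) :
    KloostermanRing F →ₐ[F] Ω :=
  AlgHom.ofLinearMap
    { toFun := fun f => aeval y f.re + aeval y f.im * x
      map_add' := fun f g => by
        simp only [re_add, im_add, map_add]
        ring
      map_smul' := fun a f => by
        simp only [re_smul, im_smul, map_smul, RingHom.id_apply, smul_add, smul_mul_assoc] }
    (by simp)
    (fun f g => by
      simp only [LinearMap.coe_mk, AddHom.coe_mk, re_mul, im_mul, map_add, map_mul, map_neg,
        map_one, map_sub, map_pow, aeval_X]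
      linear_combination - aeval y f.im * aeval y g.im * h)

variable {x y : Ω} (h : x * x = (y ^ Fintype.card F - y) * x - 1)

lemma evalHom_apply (f : KloostermanRing F) : evalHom h f = aeval y f.re + aeval y f.im * x := rfl

lemma evalHom_mono (c : F) (A i j : ℕ) :
    evalHom h (mono c A i j) = x ^ i * x⁻¹ ^ A * (y + algebraMap F Ω c) ^ j := by
  have hx : x ≠ 0 := by
    rintro rfl
    simp at h
  have h1 : evalHom h ω = x := by simp [evalHom_apply]
  have h2 : evalHom h omegaInv = x⁻¹ := by
    rw [← mul_right_inj' hx, mul_inv_cancel₀ hx, ← map_one (evalHom h), ← omega_mul_omegaInv,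
      map_mul, h1]
  have h3 : evalHom h (algebraMap F[X] (KloostermanRing F) (X + C c)) = y + algebraMap F Ω c := by
    simp [evalHom_apply]
  rw [mono, map_pow, map_mul, map_mul, map_pow, map_pow, map_pow, h1, h2, h3]

lemma evalHom_auxFun_pow {r A A' s : ℕ} (hr : r = Fintype.card F ^ s) {c : F}
    (hx : x ^ (r * r) = x) (hy : y ^ (r * r) = y + algebraMap F Ω c)
    (a : StepanovIndex (Fintype.card F) A A' → F) :
    evalHom h (auxFun r A A' a) ^ r = evalHom h (auxTransform r A A' c a) := by
  obtain ⟨Φ, hΦ⟩ : ∃ Φ : Ω →ₐ[F] Ω, ∀ z, Φ z = z ^ r := by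
    refine ⟨FiniteField.frobeniusAlgHom F Ω ^ s, fun z => ?_⟩
    rw [AlgHom.coe_pow, FiniteField.coe_frobeniusAlgHom, pow_iterate, hr]
  rw [← hΦ, auxFun, auxTransform_apply]
  simp only [map_sum, map_smul, map_mul, map_pow]
  refine Finset.sum_congr rfl fun k _ => ?_
  rw [hΦ, hΦ]
  congr 2
  rw [evalHom_mono, evalHom_mono, map_zero, add_zero]
  calc _ = (x ^ (r * r)) ^ (k.2.1 : ℕ) * (x ^ (r * r))⁻¹ ^ A' * (y ^ (r * r)) ^ (k.2.2 : ℕ) := by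
        rw [← inv_pow]
        ring
    _ = _ := by rw [hx, hy]

lemma aeval_auxFun_eq_zero (hxy : y ^ Fintype.card F - y = x + x⁻¹) (hx0 : x ≠ 0) (hx1 : x ≠ x⁻¹)
    {r A A' s : ℕ} (hr : r = Fintype.card F ^ s) {c : F}
    (hx : x ^ (r * r) = x) (hy : y ^ (r * r) = y + algebraMap F Ω c)
    {a : StepanovIndex (Fintype.card F) A A' → F} (ha : auxTransform r A A' c a = 0) :
    aeval y (auxFun r A A' a).re = 0 ∧ aeval y (auxFun r A A' a).im = 0 := by
  have hr0 : r ≠ 0 := by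
    rw [hr]
    exact pow_ne_zero _ Fintype.card_ne_zero
  have h1 : x * x = (y ^ Fintype.card F - y) * x - 1 := by
    rw [hxy, add_mul, inv_mul_cancel₀ hx0, add_sub_cancel_right]
  have h2 : x⁻¹ * x⁻¹ = (y ^ Fintype.card F - y) * x⁻¹ - 1 := by
    rw [hxy, add_mul, mul_inv_cancel₀ hx0, add_sub_cancel_left]
  have e1 := evalHom_auxFun_pow h1 hr hx hy a
  have e2 := evalHom_auxFun_pow h2 hr (by rw [inv_pow, hx]) hy a
  rw [ha, map_zero, pow_eq_zero_iff hr0, evalHom_apply] at e1 e2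
  have him : aeval y (auxFun r A A' a).im = 0 := by
    refine (mul_eq_zero.1 ?_).resolve_right (sub_ne_zero.2 hx1)
    linear_combination e1 - e2
  rw [him, zero_mul, add_zero] at e1
  exact ⟨e1, him⟩

end Evaluation

section Counting
variable {E Ω : Type*} [Field E] [Algebra F E] [Field Ω] [Algebra F Ω]

lemma pow_card_pow_eq_add_sum {y u : Ω} (h : y ^ Fintype.card F - y = u) (m : ℕ) :
    y ^ Fintype.card F ^ m = y + ∑ i ∈ Finset.range m, u ^ Fintype.card F ^ i := by
  induction m with
  | zero => simp
  | succ m ih =>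
    have hadd : ∀ z w : Ω, (z + w) ^ Fintype.card F ^ m =
        z ^ Fintype.card F ^ m + w ^ Fintype.card F ^ m := by
      intro z w
      have := map_add (FiniteField.frobeniusAlgHom F Ω ^ m) z w
      rwa [AlgHom.coe_pow, FiniteField.coe_frobeniusAlgHom, pow_iterate] at this
    rw [Finset.sum_range_succ, ← add_assoc, ← ih, ← hadd, ← h, add_sub_cancel, pow_succ' _ m,
      pow_mul]

variable [Fintype E] [Algebra E Ω] [IsScalarTower F E Ω]

lemma pow_card_eq_add_trace {y : Ω} {u : E} (h : y ^ Fintype.card F - y = algebraMap E Ω u) :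
    y ^ Fintype.card F ^ Module.finrank F E = y + algebraMap F Ω (Algebra.trace F E u) := by
  rw [pow_card_pow_eq_add_sum h, IsScalarTower.algebraMap_apply F E Ω,
    FiniteField.algebraMap_trace_eq_sum_pow, map_sum, Nat.card_eq_fintype_card]
  simp_rw [map_pow]

lemma card_mul_card_le [DecidableEq F] [DecidableEq E] {s A A' : ℕ}
    (hs : Module.finrank F E = 2 * s) (c : F)
    (hA : Fintype.card F * (2 * A + 1) ≤ Fintype.card F ^ s)
    (hlt : 2 * (Fintype.card F ^ s * (Fintype.card F * (A + 1)) + Fintype.card F * (A' + 1) + 1) <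
      Fintype.card F + (2 * A + 1) * Fintype.card F * ((2 * A' + 1) * Fintype.card F)) :
    Fintype.card F * #{x : E | x ≠ 0 ∧ x ≠ x⁻¹ ∧ Algebra.trace F E (x + x⁻¹) = c} ≤
      2 * (Fintype.card F * (A + 1) + Fintype.card F ^ s * (Fintype.card F * (A' + 1))) := by
  classical
  let Ω := AlgebraicClosure E
  obtain ⟨a, ha0, ha⟩ := exists_auxTransform_eq_zero c rfl hlt
  have hH := auxFun_ne_zero hA ha0
  have hpole := poleLE_auxFun (Fintype.card F ^ s) A A' a
  set H := auxFun (Fintype.card F ^ s) A A' a with hHdef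
  obtain ⟨P, hP0, hPdeg, hP⟩ : ∃ P : Polynomial F, P ≠ 0 ∧ P.natDegree ≤
      Fintype.card F * (A + 1) + Fintype.card F ^ s * (Fintype.card F * (A' + 1)) ∧
      ∀ y : Ω, aeval y H.re = 0 ∧ aeval y H.im = 0 → aeval y P = 0 := by
    by_cases hre : H.re = 0
    · refine ⟨H.im, fun him => hH (QuadraticAlgebra.ext hre him),
        natDegree_le_iff_degree_le.2 (le_trans ?_ hpole.2), fun y h => h.2⟩
      exact le_add_of_nonneg_right (by exact_mod_cast Nat.zero_le _)
    · exact ⟨H.re, hre, natDegree_le_iff_degree_le.2 hpole.1, fun y h => h.1⟩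
  have hy : ∀ u : E, ∃ y : Ω, y ^ Fintype.card F - y = algebraMap E Ω u := by
    intro u
    have hdeg : (X ^ Fintype.card F - X - C (algebraMap E Ω u) : Polynomial Ω).natDegree =
        Fintype.card F := by
      rw [natDegree_sub_C, FiniteField.X_pow_card_sub_X_natDegree_eq Ω Fintype.one_lt_card]
    obtain ⟨y, hy⟩ := IsAlgClosed.exists_root (X ^ Fintype.card F - X - C (algebraMap E Ω u) : Polynomial Ω)
      (fun h => Fintype.card_ne_zero (α := F) (hdeg ▸ natDegree_eq_of_degree_eq_some h))
    refine ⟨y, sub_eq_zero.1 ?_⟩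
    simpa [IsRoot] using hy
  choose Y hY using hy
  set S : Finset E := {x : E | x ≠ 0 ∧ x ≠ x⁻¹ ∧ Algebra.trace F E (x + x⁻¹) = c} with hS
  have hfY : ∀ (x : E) (t : F), (Y (x + x⁻¹) + algebraMap F Ω t) ^ Fintype.card F -
      (Y (x + x⁻¹) + algebraMap F Ω t) = algebraMap E Ω x + (algebraMap E Ω x)⁻¹ := by
    intro x t
    have := map_add (FiniteField.frobeniusAlgHom F Ω) (Y (x + x⁻¹)) (algebraMap F Ω t)
    rw [AlgHom.commutes] at this
    simp only [FiniteField.coe_frobeniusAlgHom] at this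
    rw [this, add_sub_add_right_eq_sub, hY, map_add, map_inv₀]
  have hcard : Fintype.card E = Fintype.card F ^ s * Fintype.card F ^ s := by
    rw [Module.card_eq_pow_finrank (K := F), hs, two_mul, pow_add]
  calc Fintype.card F * #S = #(S ×ˢ (Finset.univ : Finset F)) := by
        rw [Finset.card_product, Finset.card_univ, mul_comm]
    _ ≤ 2 * #((S ×ˢ (Finset.univ : Finset F)).image
          fun p => Y (p.1 + p.1⁻¹) + algebraMap F Ω p.2) := by
        refine Finset.card_le_mul_card_image _ _ fun b hb => ?_
        obtain ⟨⟨x₀, t₀⟩, hmem, rfl⟩ := Finset.mem_image.1 hb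
        refine (Finset.card_le_card_of_injOn (t := {x₀, x₀⁻¹}) Prod.fst ?_ ?_).trans
          Finset.card_le_two
        · rintro ⟨x, t⟩ hp
          simp only [Finset.coe_filter, Set.mem_ofPred_eq, Finset.mem_product, hS,
            Finset.mem_filter, Finset.mem_univ, true_and, and_true] at hp
          have hx₀ : x₀ ≠ 0 := by
            have := (Finset.mem_product.1 hmem).1
            simp only [hS, Finset.mem_filter] at this
            exact this.2.1
          have hv := hfY x t
          rw [hp.2, hfY, ← map_inv₀, ← map_inv₀, ← map_add, ← map_add] at hv
          have hv := (algebraMap E Ω).injective hv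
          have h0 := hp.1.1
          have : (x - x₀) * (x * x₀ - 1) = 0 := by
            field_simp at hv
            linear_combination -hv
          simp only [Finset.coe_insert, Finset.coe_singleton, Set.mem_insert_iff,
            Set.mem_singleton_iff]
          rcases mul_eq_zero.1 this with h | h
          · exact Or.inl (sub_eq_zero.1 h)
          · exact Or.inr (eq_inv_of_mul_eq_one_left (sub_eq_zero.1 h))
        · rintro ⟨x, t⟩ hp ⟨x', t'⟩ hp' hxx
          simp only [Finset.coe_filter, Set.mem_ofPred_eq] at hp hp' hxx
          subst hxx
          have := hp.2.trans hp'.2.symm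
          rw [add_right_inj] at this
          rw [(algebraMap F Ω).injective this]
    _ ≤ 2 * P.natDegree := by
        refine Nat.mul_le_mul_left _ ?_
        refine (Finset.card_le_card (t := (P.aroots Ω).toFinset) ?_).trans
          ((Multiset.toFinset_card_le _).trans ((card_roots' _).trans natDegree_map_le))
        rintro _ hb
        obtain ⟨⟨x, t⟩, hx, rfl⟩ := Finset.mem_image.1 hb
        simp only [hS, Finset.mem_product, Finset.mem_filter, Finset.mem_univ, true_and,
          and_true] at hx
        obtain ⟨hx0, hx1, hxc⟩ := hx
        rw [Multiset.mem_toFinset, mem_aroots]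
        refine ⟨hP0, hP _ (aeval_auxFun_eq_zero (x := algebraMap E Ω x) (hfY x t) ?_ ?_ rfl
          (c := c) ?_ ?_ ha)⟩
        · simpa using hx0
        · rw [← map_inv₀]
          exact fun h => hx1 ((algebraMap E Ω).injective h)
        · rw [← map_pow, ← hcard, FiniteField.pow_card]
        · rw [← hxc, ← pow_add, ← two_mul, ← hs]
          refine pow_card_eq_add_trace ?_
          rw [hfY, map_add, map_inv₀]
    _ ≤ _ := Nat.mul_le_mul_left _ hPdeg

end Counting

end KloostermanRing
end CoordinateRing

section PowerSumBound
variable {F E : Type*} [Field F] [Fintype F] [DecidableEq F]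
  [Field E] [Algebra F E] [Fintype E] [DecidableEq E]

lemma card_ne_inv_trace_le {s : ℕ} (hs : Module.finrank F E = 2 * s) (h3 : 3 ≤ s) (c : F) :
    #{x : E | x ≠ 0 ∧ x ≠ x⁻¹ ∧ Algebra.trace F E (x + x⁻¹) = c} ≤
      Fintype.card F ^ (2 * s - 1) + 9 * Fintype.card F ^ s := by
  obtain ⟨k, rfl⟩ := Nat.exists_eq_add_of_le' h3
  have hcount := KloostermanRing.card_mul_card_le hs c (A := (Fintype.card F ^ (k + 2) - 1) / 2)
    (A' := (Fintype.card F ^ (k + 2) - 1) / 2 + 3)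
  have hq : 2 ≤ Fintype.card F := Fintype.one_lt_card
  have hQ : Fintype.card F * Fintype.card F ≤ Fintype.card F ^ (k + 2) := by
    rw [pow_add, sq]
    exact Nat.le_mul_of_pos_left _ (pow_pos (by omega) _)
  have h4 : 4 ≤ Fintype.card F ^ (k + 2) := by nlinarith
  have hr : Fintype.card F ^ (k + 3) = Fintype.card F * Fintype.card F ^ (k + 2) := by ring
  have hr' : Fintype.card F ^ (2 * (k + 3) - 1) =
      Fintype.card F ^ (k + 3) * Fintype.card F ^ (k + 2) := by
    rw [← pow_add]
    congr 1
    omega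
  obtain ⟨A, hA⟩ : ∃ A, A = (Fintype.card F ^ (k + 2) - 1) / 2 := ⟨_, rfl⟩
  rw [← hA] at hcount
  have hA1 : 2 * A + 1 ≤ Fintype.card F ^ (k + 2) := by omega
  have hA2 : Fintype.card F ^ (k + 2) ≤ 2 * A + 2 := by omega
  have hA3 : 1 ≤ A := by omega
  rw [hr', hr]
  rw [hr] at hcount
  generalize Fintype.card F ^ (k + 2) = Q at *
  generalize Fintype.card F = q at *
  have hcount := hcount (Nat.mul_le_mul_left _ hA1) (by
    have hq' : q * Q ≤ q * (2 * A + 2) := Nat.mul_le_mul_left _ hA2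
    have h5 : q * Q * (q * (A + 1)) ≤ q * (2 * A + 2) * (q * (A + 1)) :=
      Nat.mul_le_mul_right _ hq'
    have h6 : 2 * q ≤ q * q := Nat.mul_le_mul_right _ hq
    have h7 : q * A * 2 ≤ q * A * q := Nat.mul_le_mul_left _ hq
    have h8 : q * q * 1 ≤ q * q * A := Nat.mul_le_mul_left _ hA3
    nlinarith)
  have hcount : #{x : E | x ≠ 0 ∧ x ≠ x⁻¹ ∧ Algebra.trace F E (x + x⁻¹) = c} ≤
      2 * (A + 1 + q * Q * (A + 3 + 1)) := by
    refine Nat.le_of_mul_le_mul_left (hcount.trans_eq ?_) (by omega : 0 < q)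
    ring
  refine hcount.trans ?_
  have h5 : q * Q * (2 * A + 1) ≤ q * Q * Q := Nat.mul_le_mul_left _ hA1
  have h6 : 2 * Q ≤ q * Q := Nat.mul_le_mul_right _ hq
  nlinarith

lemma card_units_trace_le {s : ℕ} (hs : Module.finrank F E = 2 * s) (h3 : 3 ≤ s) (c : F) :
    #{x : Eˣ | Algebra.trace F E ((x : E) + (x : E)⁻¹) = c} ≤
      Fintype.card F ^ (2 * s - 1) + 11 * Fintype.card F ^ s := by
  have h1 := card_ne_inv_trace_le (E := E) hs h3 c
  have h2 : #{x : Eˣ | Algebra.trace F E ((x : E) + (x : E)⁻¹) = c} ≤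
      #(({x : E | x ≠ 0 ∧ x ≠ x⁻¹ ∧ Algebra.trace F E (x + x⁻¹) = c} : Finset E) ∪ {1, -1}) := by
    refine Finset.card_le_card_of_injOn Units.val ?_ Units.val_injective.injOn
    intro x hx
    simp only [Finset.coe_filter, Finset.mem_univ, true_and, Set.mem_ofPred_eq] at hx
    simp only [Finset.mem_coe, Finset.mem_union, Finset.mem_filter, Finset.mem_univ, true_and,
      Finset.mem_insert, Finset.mem_singleton]
    by_cases h : (x : E) = (x : E)⁻¹
    · right
      rw [← sq_eq_one_iff, sq]
      nth_rewrite 2 [h]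
      exact mul_inv_cancel₀ x.ne_zero
    · exact Or.inl ⟨x.ne_zero, h, hx⟩
  have h3 := Finset.card_union_le
    ({x : E | x ≠ 0 ∧ x ≠ x⁻¹ ∧ Algebra.trace F E (x + x⁻¹) = c} : Finset E) {1, -1}
  have h4 : #({1, -1} : Finset E) ≤ 2 := Finset.card_le_two
  have h5 : 1 ≤ Fintype.card F ^ s := Nat.one_le_pow _ _ Fintype.card_pos
  omega

lemma norm_kloostermanSum_traceChar_le (ψ : AddChar F ℂ) (hψ : ψ ≠ 1) {s : ℕ}
    (hs : Module.finrank F E = 2 * s) (h3 : 3 ≤ s) :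
    ‖kloostermanSum (traceChar E ψ)‖ ≤
      (22 * Fintype.card F + 1) * (Fintype.card F : ℝ) ^ s := by
  set N : F → ℕ := fun c => #{x : Eˣ | Algebra.trace F E ((x : E) + (x : E)⁻¹) = c} with hN
  have hsum : kloostermanSum (traceChar E ψ) = ∑ c, (N c : ℂ) * ψ c := by
    rw [kloostermanSum, ← Finset.sum_fiberwise (s := Finset.univ)
      (g := fun x : Eˣ => Algebra.trace F E ((x : E) + (x : E)⁻¹))]
    refine Finset.sum_congr rfl fun c _ => ?_
    rw [← nsmul_eq_mul]
    refine Finset.sum_eq_card_nsmul fun x hx => ?_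
    rw [traceChar_apply, (Finset.mem_filter.1 hx).2]
  have htot : ∑ c, N c = Fintype.card F ^ (2 * s) - 1 := by
    rw [← hs, ← Module.card_eq_pow_finrank, ← Fintype.card_units, ← Finset.card_univ]
    exact (Finset.card_eq_sum_card_fiberwise (fun _ _ => Finset.mem_univ _)).symm
  have hψ0 : ∑ c, ψ c = 0 := AddChar.sum_eq_zero_of_ne_one hψ
  have hq : (1 : ℝ) ≤ Fintype.card F := by exact_mod_cast Fintype.card_pos
  have hpow : (Fintype.card F : ℝ) ^ (2 * s) =
      Fintype.card F * (Fintype.card F : ℝ) ^ (2 * s - 1) := by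
    rw [← pow_succ']
    congr 1
    omega
  calc ‖kloostermanSum (traceChar E ψ)‖
      = ‖∑ c, ((N c : ℝ) - (Fintype.card F : ℝ) ^ (2 * s - 1) : ℝ) * ψ c‖ := by
        rw [hsum]
        push_cast
        simp_rw [sub_mul]
        rw [Finset.sum_sub_distrib, ← Finset.mul_sum, hψ0, mul_zero, sub_zero]
    _ ≤ ∑ c, |(N c : ℝ) - (Fintype.card F : ℝ) ^ (2 * s - 1)| := by
        refine (norm_sum_le _ _).trans_eq (Finset.sum_congr rfl fun c _ => ?_)
        rw [norm_mul, AddChar.norm_apply, mul_one, Complex.norm_real, Real.norm_eq_abs]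
    _ ≤ ∑ c, (22 * (Fintype.card F : ℝ) ^ s -
          ((N c : ℝ) - (Fintype.card F : ℝ) ^ (2 * s - 1))) := by
        refine Finset.sum_le_sum fun c _ => ?_
        have h1 : (N c : ℝ) ≤ (Fintype.card F ^ (2 * s - 1) + 11 * Fintype.card F ^ s : ℕ) :=
          Nat.cast_le.2 (card_units_trace_le hs h3 c)
        push_cast at h1
        have h2 : (0 : ℝ) ≤ (Fintype.card F : ℝ) ^ s := by positivity
        rw [abs_le]
        constructor <;> linarith
    _ = 22 * Fintype.card F * (Fintype.card F : ℝ) ^ s + 1 := by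
        rw [Finset.sum_sub_distrib, Finset.sum_sub_distrib, Finset.sum_const, Finset.sum_const,
          Finset.card_univ, ← Nat.cast_sum, htot,
          Nat.cast_sub (Nat.one_le_pow _ _ Fintype.card_pos), Nat.cast_pow, hpow]
        simp only [nsmul_eq_mul, Nat.cast_one]
        ring
    _ ≤ _ := by
        have := one_le_pow₀ hq (n := s)
        linarith

lemma norm_kloostermanPowerSum_le (ψ : AddChar F ℂ) (hψ : ψ ≠ 1) {s : ℕ} (h3 : 3 ≤ s) :
    ‖kloostermanPowerSum ψ (2 * s)‖ ≤
      (22 * Fintype.card F + 1) * (Fintype.card F : ℝ) ^ s := by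
  classical
  have : Fact (ringChar F).Prime := ⟨CharP.char_is_prime F _⟩
  have : NeZero (2 * s) := ⟨by omega⟩
  have : Fintype (FiniteField.Extension F (ringChar F) (2 * s)) := Fintype.ofFinite _
  have hfin := FiniteField.finrank_extension F (ringChar F) (2 * s)
  have h := norm_kloostermanSum_traceChar_le
    (E := FiniteField.Extension F (ringChar F) (2 * s)) ψ hψ hfin h3
  rwa [kloostermanSum_traceChar, hfin] at h

/-- Weil's bound for Kloosterman sums. -/
lemma norm_kloostermanSum_le (ψ : AddChar F ℂ) (hψ : ψ ≠ 1) :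
    ‖kloostermanSum ψ‖ ≤ 2 * √(Fintype.card F) :=
  norm_kloostermanSum_le_of_power_sum_bound ψ hψ fun _ hs => norm_kloostermanPowerSum_le ψ hψ hs

end PowerSumBound

end SlTwoExponentialSum

/-- There is an absolute constant `C` such that for every finite field
`F` and every nontrivial additive character `ψ` of `F`,
`|∑_{g ∈ SL₂(F)} ψ(tr g)| ≤ |SL₂(F)| · C · |F|^(-3/2)`. -/
theorem stmt6 :
    ∃ C : ℝ, 0 < C ∧
      ∀ (F : Type) [Field F] [Fintype F] [DecidableEq F] (ψ : AddChar F ℂ), ψ ≠ 1 →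
        ‖∑ g : Matrix.SpecialLinearGroup (Fin 2) F, ψ (Matrix.trace (g.val))‖
          ≤ (Fintype.card (Matrix.SpecialLinearGroup (Fin 2) F) : ℝ) * C *
              (Fintype.card F : ℝ) ^ (-(3:ℝ)/2) := by
  refine ⟨4, by norm_num, fun F _ _ _ ψ hψ => ?_⟩
  have hK := norm_kloostermanSum_le ψ hψ
  have hcard := card_slTwo_ge (F := F)
  have hq : (0 : ℝ) < Fintype.card F := by exact_mod_cast Fintype.card_pos
  rw [sum_trace_slTwo ψ hψ, norm_mul, Complex.norm_natCast]
  have h1 : (Fintype.card F : ℝ) ^ 3 * (Fintype.card F : ℝ) ^ (-(3 : ℝ) / 2) =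
      Fintype.card F * √(Fintype.card F) := by
    rw [← Real.rpow_natCast, ← Real.rpow_add hq, Real.sqrt_eq_rpow, ← Real.rpow_one_add' hq.le]
    · norm_num
    · norm_num
  calc _ ≤ (Fintype.card F : ℝ) * (2 * √(Fintype.card F)) := by gcongr
    _ = 2 * ((Fintype.card F : ℝ) ^ 3 * (Fintype.card F : ℝ) ^ (-(3 : ℝ) / 2)) := by
        rw [h1]
        ring
    _ ≤ 2 * (2 * (Fintype.card (Matrix.SpecialLinearGroup (Fin 2) F) : ℝ) *
          (Fintype.card F : ℝ) ^ (-(3 : ℝ) / 2)) := by gcongr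
    _ = _ := by ring
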